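/- (Sandwich step in the asynchronous iteration proof.) In the deterministic setting (ω_{n,k} = 0), suppose additionally that ε > 0, k_t ∈ ℕ and D_t > 0 are such that ‖y_k‖_∞ ≤ D_t, |ε̄_k| ≤ ε D_t and |ε_k| ≤ ε D_t for all k ≥ k_t. For each n ∈ N define Y_{n,k} recursively by Y_{n,k_t} := D_t and Y_{n,k+1} := (1 − β_{n,k}) Y_{n,k} + β_{n,k} γ (1 + ε) D_t for k ≥ k_t. Then −Y_{n,k} ≤ y_{n,k} ≤ Y_{n,k} for every n ∈ N and every k ≥ k_t. -/

import Mathlib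

open Finset Filter Topology

/-- the sup-norm of a vector indexed by a finite nonempty type -/
noncomputable def supNorm {N : Type} [Fintype N] [Nonempty N] (v : N → ℝ) : ℝ :=
  Finset.univ.sup' Finset.univ_nonempty fun n => |v n|

theorem abs_apply_le_supNorm {N : Type} [Fintype N] [Nonempty N] (v : N → ℝ) (n : N) :
    |v n| ≤ supNorm v :=
  Finset.le_sup' (fun n => |v n|) (Finset.mem_univ n)

/-- Sandwich step in the proof of the asynchronous iteration convergence theorem
(deterministic case `ω_{n,k} = 0`): the auxiliary iterates `Y_{n,k}` started from `D_t`
bound `y_{n,k}` from above and below for all `k ≥ k_t`. -/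
theorem async_iteration_sandwich {N : Type} [Fintype N] [Nonempty N]
    (γ : ℝ) (hγ0 : 0 < γ) (hγ1 : γ < 1)
    (y : ℕ → N → ℝ) (β : N → ℕ → ℝ) (εup εlow : ℕ → ℝ)
    (hβmem : ∀ n k, β n k ∈ Set.Icc (0:ℝ) 1)
    (hub : ∀ n k, y (k+1) n
      ≤ (1 - β n k) * y k n + β n k * γ * supNorm (y k) + β n k * γ * εup k)
    (hlb : ∀ n k, y (k+1) n
      ≥ (1 - β n k) * y k n - β n k * γ * supNorm (y k) + β n k * γ * εlow k)
    (ε Dt : ℝ) (hε : 0 < ε) (hDt : 0 < Dt) (kt : ℕ)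
    (hbdd : ∀ k, kt ≤ k → supNorm (y k) ≤ Dt)
    (hεup : ∀ k, kt ≤ k → |εup k| ≤ ε * Dt)
    (hεlow : ∀ k, kt ≤ k → |εlow k| ≤ ε * Dt)
    (Y : N → ℕ → ℝ)
    (hYinit : ∀ n, Y n kt = Dt)
    (hYrec : ∀ n k, kt ≤ k → Y n (k+1) = (1 - β n k) * Y n k + β n k * γ * (1 + ε) * Dt) :
    ∀ n k, kt ≤ k → -Y n k ≤ y k n ∧ y k n ≤ Y n k := by
  intro n k hk
  induction k, hk using Nat.le_induction with
  | base =>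
    rw [hYinit n]
    exact abs_le.mp ((abs_apply_le_supNorm (y kt) n).trans (hbdd kt le_rfl))
  | succ k hk ih =>
    obtain ⟨hβ0, hβ1⟩ := hβmem n k
    have hβγ : 0 ≤ β n k * γ := mul_nonneg hβ0 hγ0.le
    have hnorm := mul_le_mul_of_nonneg_left (hbdd k hk) hβγ
    have hup := mul_le_mul_of_nonneg_left (abs_le.mp (hεup k hk)).2 hβγ
    have hlow := mul_le_mul_of_nonneg_left (abs_le.mp (hεlow k hk)).1 hβγ
    have hY_lower := mul_le_mul_of_nonneg_left ih.1 (sub_nonneg.mpr hβ1)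
    have hY_upper := mul_le_mul_of_nonneg_left ih.2 (sub_nonneg.mpr hβ1)
    rw [hYrec n k hk]
    constructor
    · linarith [hlb n k]
    · linarith [hub n k]
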